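/- arXiv:1303.1239 — 5 statements merged into one kernel-verified Lean document; each statement's English description precedes it below -/
import Mathlib

section
/- Let R be a commutative ring with 1 and let f_1,…,f_n and g_1,…,g_n be elements of R. Put h_i = f_i·g_i for each 1 ≤ i ≤ n. If each f_i is not a unit of R and the sequence h_1,…,h_n is an R-sequence, then f_1,…,f_n is also an R-sequence. -/
/-- A list `f₁, …, f_q` of elements of a commutative ring `R` is an *`R`-regular sequence*
if no `fᵢ` is a unit, and for each `i`, `f_{i+1}` is a non-zero-divisor on
`R/(f₁, …, fᵢ)`, i.e. `f_{i+1} * x ∈ (f₁, …, fᵢ)` implies `x ∈ (f₁, …, fᵢ)`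
(the case `i = 0` says that `f₁` is a non-zero-divisor on `R`). -/
def IsRegularSeq {R : Type*} [CommRing R] (fs : List R) : Prop :=
  (∀ f ∈ fs, ¬ IsUnit f) ∧
  ∀ i : Fin fs.length, ∀ x : R,
    fs.get i * x ∈ Ideal.span {y | y ∈ fs.take i.1} →
    x ∈ Ideal.span {y | y ∈ fs.take i.1}

/-- A list is an *`R`-sequence* if every permutation of it is an `R`-regular sequence. -/
def IsRSeq {R : Type*} [CommRing R] (fs : List R) : Prop :=
  ∀ gs : List R, gs.Perm fs → IsRegularSeq gs

def PW {R : Type*} [CommRing R] {n : ℕ} (h : Fin n → R) : Prop :=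
  ∀ (T : Set (Fin n)) (i : Fin n), i ∉ T → ∀ x : R,
    h i * x ∈ Ideal.span (h '' T) → x ∈ Ideal.span (h '' T)

theorem PW_step {R : Type*} [CommRing R] {n : ℕ} (h k : Fin n → R) (j : Fin n) (b : R)
    (hP : PW h) (hk : ∀ i, i ≠ j → k i = h i) (hj : h j = k j * b) : PW k := by
  intro T i hi x hx
  by_cases hjT : j ∈ T
  · have hij : i ≠ j := fun e => hi (e ▸ hjT)
    have himg : k '' T = insert (k j) (h '' (T \ {j})) := by
      rw [← Set.image_congr (f := k) (g := h) (s := T \ {j}) (fun a ha => hk a ha.2),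
        ← Set.image_insert_eq, Set.insert_sdiff_singleton, Set.insert_eq_of_mem hjT]
    rw [himg, hk i hij, Ideal.mem_span_insert] at hx
    rw [himg, Ideal.mem_span_insert]
    obtain ⟨y, z, hz, e⟩ := hx
    have h1 : h j * y ∈ Ideal.span (h '' (insert i (T \ {j}))) := by
      rw [Set.image_insert_eq, Ideal.mem_span_insert]
      refine ⟨b * x, -b * z, Ideal.mul_mem_left _ _ hz, ?_⟩
      rw [hj]
      linear_combination (-b) * e
    have h2 := hP _ j (by simp [Ne.symm hij]) y h1
    rw [Set.image_insert_eq, Ideal.mem_span_insert] at h2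
    obtain ⟨u, w, hw, e2⟩ := h2
    have h3 : h i * (x - k j * u) ∈ Ideal.span (h '' (T \ {j})) := by
      have : h i * (x - k j * u) = k j * w + z := by
        linear_combination e + k j * e2
      rw [this]
      exact add_mem (Ideal.mul_mem_left _ _ hw) hz
    have h4 := hP _ i (fun hh => hi hh.1) _ h3
    exact ⟨u, _, h4, by ring⟩
  · have himg : k '' T = h '' T :=
      Set.image_congr (fun a ha => hk a (fun e => hjT (e ▸ ha)))
    rw [himg] at hx ⊢
    refine hP T i hi x ?_
    by_cases hij : i = j
    · subst hij
      rw [hj]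
      have := Ideal.mul_mem_left _ b hx
      convert this using 1
      ring
    · rwa [← hk i hij]

theorem PW_all {R : Type*} [CommRing R] {n : ℕ} (f g : Fin n → R)
    (hP : PW (fun i => f i * g i)) : PW f := by
  classical
  have key : ∀ S : Finset (Fin n), PW (fun i => if i ∈ S then f i else f i * g i) := by
    intro S
    induction S using Finset.induction_on with
    | empty => simpa using hP
    | insert a S ha ih =>
      refine PW_step _ _ a (g a) ih ?_ ?_
      · intro i hi
        simp [hi]
      · simp [ha]
  simpa using key Finset.univ

theorem PW_of_RSeq {R : Type*} [CommRing R] {n : ℕ} (h : Fin n → R)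
    (hh : IsRSeq (List.ofFn h)) : PW h := by
  classical
  intro T i hi x hx
  let A := T.toFinset.toList
  let B := (Finset.univ \ insert i T.toFinset).toList
  have hp : (A ++ i :: B).Perm (List.finRange n) := by
    rw [List.perm_ext_iff_of_nodup]
    · intro a
      simp [A, B]
      tauto
    · simp only [List.nodup_append, List.nodup_cons, A, B, Finset.nodup_toList, Finset.mem_toList]
      refine ⟨trivial, ⟨by simp, trivial⟩, ?_⟩
      intro a ha b hb
      simp at ha hb
      rintro rfl
      rcases hb with rfl | hb
      · exact hi ha
      · exact hb.2 ha
    · exact List.nodup_finRange n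
  have hp2 := hp.map h
  rw [← List.ofFn_eq_map] at hp2
  have := (hh _ hp2).2 ⟨A.length, by simp⟩ x
  have e : {y | y ∈ ((A ++ i :: B).map h).take A.length} = h '' T := by
    ext y
    simp [A]
  simp only [e] at this
  apply this
  simpa using hx

theorem perm_map_lift {α β : Type*} (h : α → β) (l : List α) (gs : List β)
    (hp : gs.Perm (l.map h)) : ∃ m : List α, m.Perm l ∧ gs = m.map h := by
  generalize e : l.map h = t at hp
  induction hp generalizing l with
  | nil => exact ⟨[], by simp_all, rfl⟩
  | cons x _ ih =>
    obtain ⟨a, l', rfl, rfl, rfl⟩ := List.map_eq_cons_iff.1 e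
    obtain ⟨m, hm, rfl⟩ := ih l' rfl
    exact ⟨a :: m, hm.cons a, rfl⟩
  | swap x y l0 =>
    obtain ⟨a, l', rfl, rfl, e'⟩ := List.map_eq_cons_iff.1 e
    obtain ⟨b, l'', rfl, rfl, rfl⟩ := List.map_eq_cons_iff.1 e'
    exact ⟨b :: a :: l'', List.Perm.swap _ _ _, rfl⟩
  | trans _ _ ih1 ih2 =>
    obtain ⟨m, hm, rfl⟩ := ih2 l e
    obtain ⟨m', hm', rfl⟩ := ih1 m rfl
    exact ⟨m', hm'.trans hm, rfl⟩

theorem RSeq_of_PW {R : Type*} [CommRing R] {n : ℕ} (h : Fin n → R)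
    (hu : ∀ i, ¬ IsUnit (h i)) (hP : PW h) : IsRSeq (List.ofFn h) := by
  intro gs hgs
  rw [List.ofFn_eq_map] at hgs
  obtain ⟨m, hm, rfl⟩ := perm_map_lift h _ _ hgs
  have hnd : m.Nodup := hm.nodup_iff.2 (List.nodup_finRange n)
  refine ⟨?_, ?_⟩
  · intro f hf
    obtain ⟨i, _, rfl⟩ := List.mem_map.1 hf
    exact hu i
  · rintro ⟨i, hi⟩ x hx
    have hi' : i < m.length := by simpa using hi
    have e : {y | y ∈ (m.map h).take i} = h '' {a | a ∈ m.take i} := by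
      ext y
      rw [← List.map_take]
      simp only [Set.mem_setOf_eq, List.mem_map, Set.mem_image]
    simp only [e] at hx ⊢
    refine hP _ m[i] ?_ x (by simpa using hx)
    intro hmem
    obtain ⟨j, hj, e⟩ := List.mem_iff_getElem.1 hmem
    rw [List.getElem_take] at e
    have := (hnd.getElem_inj_iff).1 e
    simp at hj
    omega

/-- If `hᵢ = fᵢ * gᵢ`, each `fᵢ` is not a unit and `h₁, …, h_n` is an
`R`-sequence, then `f₁, …, f_n` is an `R`-sequence. -/
theorem nonunit_factors_of_RSeq_is_RSeq {R : Type*} [CommRing R] {n : ℕ}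
    (f g : Fin n → R) (hf : ∀ i, ¬ IsUnit (f i))
    (hh : IsRSeq (List.ofFn (fun i => f i * g i))) :
    IsRSeq (List.ofFn f) := by
  exact RSeq_of_PW f hf (PW_all f g (PW_of_RSeq _ hh))
end

section
/- Let R be a commutative ring with 1 and let g, h ∈ R be such that g, h is an R-sequence (that is, both g, h and h, g are R-regular sequences, and g, h are non-units). If an element r ∈ R becomes a unit in the localization R_g and also becomes a unit in the localization R_h, then r is a unit in R. -/
/-- If `g, h` is an `R`-sequence and `r ∈ R` becomes a unit in both
localizations `R_g` and `R_h`, then `r` is a unit in `R`. -/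
theorem isUnit_of_isUnit_away_of_RSeq {R : Type*} [CommRing R] (g h : R)
    (hgh : IsRSeq [g, h]) (r : R)
    (h1 : IsUnit (algebraMap R (Localization.Away g) r))
    (h2 : IsUnit (algebraMap R (Localization.Away h) r)) :
    IsUnit r := by
  have hg : ∀ x : R, g * x = 0 → x = 0 := by
    intro x hx
    have := (hgh [g, h] (List.Perm.refl _)).2 ⟨0, by simp⟩ x
    simpa [hx] using this
  have hh : ∀ x : R, g ∣ h * x → g ∣ x := by
    intro x hx
    have := (hgh [g, h] (List.Perm.refl _)).2 ⟨1, by simp⟩ x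
    simpa [Ideal.mem_span_singleton, hx] using this
  have hhm : ∀ (m : ℕ) (x : R), g ∣ h ^ m * x → g ∣ x := by
    intro m
    induction m with
    | zero => intro x hx; simpa using hx
    | succ k ih =>
      intro x hx
      apply ih
      apply hh
      rwa [← mul_assoc, ← pow_succ']
  have hgn : ∀ (n : ℕ) (x : R), g ^ n * x = 0 → x = 0 := by
    intro n
    induction n with
    | zero => intro x hx; simpa using hx
    | succ k ih =>
      intro x hx
      apply ih
      apply hg
      rwa [← mul_assoc, ← pow_succ']
  have key : ∀ f : R, IsUnit (algebraMap R (Localization.Away f) r) →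
      ∃ (n : ℕ) (a : R), r * a = f ^ n := by
    intro f hf
    rw [IsLocalization.algebraMap_isUnit_iff (Submonoid.powers f)] at hf
    obtain ⟨y, ⟨n, hn⟩, a, ha⟩ := hf
    exact ⟨n, a, by simp_all⟩
  obtain ⟨n, a, ha⟩ := key g h1
  obtain ⟨m, b, hb⟩ := key h h2
  induction n generalizing a with
  | zero => exact IsUnit.of_mul_eq_one a (by simpa using ha)
  | succ k ih =>
    have e : h ^ m * a - g ^ (k + 1) * b = 0 := by
      rw [← ha, ← hb]; ring
    obtain ⟨c, rfl⟩ := hhm m a ⟨g ^ k * b, by linear_combination e⟩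
    exact ih c (sub_eq_zero.mp (hg _ (by linear_combination ha)))
end

section
/- Let R be a commutative ring with 1, let φ : R^⊕n → R^⊕n be an R-module homomorphism, and suppose the cokernel of φ is annihilated by a non-zero-divisor g ∈ R. Then: (1) there exist an element b ∈ R and a natural number m such that (det φ)·b = g^m; (2) det φ is a non-zero-divisor in R; (3) φ is injective. -/
/-- Let `φ : R^n → R^n` be an `R`-linear endomorphism whose cokernel is
annihilated by a non-zero-divisor `g ∈ R` (i.e. `g • y ∈ range φ` for all `y`). Then
(1) `(det φ) * b = g ^ m` for some `b ∈ R`, `m : ℕ`; (2) `det φ` is a non-zero-divisor;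
(3) `φ` is injective. -/
theorem det_dvd_pow_and_injective_of_cokernel_annihilated {R : Type*} [CommRing R] {n : ℕ}
    (φ : (Fin n → R) →ₗ[R] (Fin n → R)) (g : R) (hg : g ∈ nonZeroDivisors R)
    (hann : ∀ y : Fin n → R, g • y ∈ LinearMap.range φ) :
    (∃ (b : R) (m : ℕ), LinearMap.det φ * b = g ^ m) ∧
    LinearMap.det φ ∈ nonZeroDivisors R ∧
    Function.Injective φ := by
  choose f hf using hann
  let ψ : (Fin n → R) →ₗ[R] (Fin n → R) :=
    (Pi.basisFun R (Fin n)).constr R (fun i => f (Pi.basisFun R (Fin n) i))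
  have hψ : φ ∘ₗ ψ = g • LinearMap.id := by
    refine (Pi.basisFun R (Fin n)).ext fun i => ?_
    rw [LinearMap.comp_apply, Module.Basis.constr_basis, hf]
    rfl
  have h1 : LinearMap.det φ * LinearMap.det ψ = g ^ n := by
    rw [← LinearMap.det_comp, hψ, LinearMap.det_smul, LinearMap.det_id, mul_one]
    rcases subsingleton_or_nontrivial R with h | h
    · exact Subsingleton.elim _ _
    · rw [Module.finrank_fin_fun]
  have h2 : LinearMap.det φ ∈ nonZeroDivisors R := by
    have := pow_mem hg n
    rw [← h1] at this
    exact (mul_mem_nonZeroDivisors.mp this).1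
  refine ⟨⟨_, n, h1⟩, h2, ?_⟩
  rw [injective_iff_map_eq_zero]
  intro x hx
  have h3 : (LinearMap.toMatrix' φ).mulVec x = 0 := by
    rw [LinearMap.toMatrix'_mulVec, hx]
  have h4 : LinearMap.det φ • x = 0 := by
    have := congrArg (fun v => (LinearMap.toMatrix' φ).adjugate.mulVec v) h3
    simp only [Matrix.mulVec_mulVec, Matrix.adjugate_mul, Matrix.smul_mulVec,
      Matrix.one_mulVec, Matrix.mulVec_zero, LinearMap.det_toMatrix'] at this
    exact this
  funext i
  have h5 := congrFun h4 i
  rw [Pi.smul_apply, smul_eq_mul, mul_comm] at h5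
  exact (mem_nonZeroDivisors_iff.mp h2).2 _ h5
end

section
/- Let x be an S-cube in an abelian category, and let U, V ⊆ S be disjoint subsets with k := #U ≥ 2 such that the restriction x|_U^V is admissible. Write U = {i_1,…,i_k}. Then for every bijection σ of U, the objects H_0^{i_1}(H_0^{i_2}(⋯(H_0^{i_k}(x))⋯))_V and H_0^{i_{σ(1)}}(H_0^{i_{σ(2)}}(⋯(H_0^{i_{σ(k)}}(x))⋯))_V are canonically isomorphic; i.e., the iterated k-direction cokernel of x at V does not depend on the order of the directions, up to canonical isomorphism. -/
open CategoryTheory CategoryTheory.Limits Opposite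

attribute [local instance] CategoryTheory.Abelian.hasFiniteBiproducts

set_option linter.unusedSectionVars false

universe w v u

/-- An `ι`-cube in a category `𝒜`: a contravariant functor from the poset of finite
subsets of `ι` (ordered by inclusion) to `𝒜`.  An `S`-cube (for `S : Finset ι`) is such a
functor, of which only the values on subsets of `S` are relevant. -/
abbrev Cube (𝒜 : Type u) [Category.{v} 𝒜] (ι : Type w) := (Finset ι)ᵒᵖ ⥤ 𝒜

namespace Cube

variable {𝒜 : Type u} [Category.{v} 𝒜] {ι : Type w} [DecidableEq ι]

/-- The vertex `x_T` of a cube `x` at a finite subset `T`. -/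
def vtx (x : Cube 𝒜 ι) (T : Finset ι) : 𝒜 := x.obj (op T)

/-- The structure morphism `x_T ⟶ x_U` of a cube for `U ⊆ T`. -/
def mapLE (x : Cube 𝒜 ι) {T U : Finset ι} (h : U ⊆ T) : x.vtx T ⟶ x.vtx U :=
  x.map (homOfLE h).op

lemma mapLE_refl (x : Cube 𝒜 ι) (T : Finset ι) (h : T ⊆ T) : x.mapLE h = 𝟙 (x.vtx T) := by
  show x.map (homOfLE h).op = _
  rw [show (homOfLE h).op = 𝟙 (op T) from rfl, x.map_id]; rfl

lemma mapLE_comp (x : Cube 𝒜 ι) {T U V : Finset ι} (h1 : U ⊆ T) (h2 : V ⊆ U) :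
    x.mapLE h1 ≫ x.mapLE h2 = x.mapLE (h2.trans h1) := by
  show x.map _ ≫ x.map _ = x.map _
  rw [← x.map_comp]
  rfl

/-- The `k`-direction boundary morphism `d^k_T : x_T ⟶ x_{T ∖ {k}}` of a cube. -/
def bd (x : Cube 𝒜 ι) (T : Finset ι) (k : ι) : x.vtx T ⟶ x.vtx (T.erase k) :=
  x.mapLE (Finset.erase_subset k T)

/-- The `k`-direction `0`-th homology `H⁰ₖ(x)` of a cube in an abelian category, an
`(S ∖ {k})`-cube: its vertex at `T` is the cokernel of the boundary morphism
`d^k_{T ∪ {k}} : x_{T ∪ {k}} ⟶ x_{(T ∪ {k}) ∖ {k}}`. -/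
noncomputable def H0 [Abelian 𝒜] (x : Cube 𝒜 ι) (k : ι) : Cube 𝒜 ι where
  obj T := cokernel (x.bd (insert k T.unop) k)
  map {T U} f :=
    cokernel.map _ _
      (x.mapLE (Finset.insert_subset_insert k (leOfHom f.unop)))
      (x.mapLE (Finset.erase_subset_erase k (Finset.insert_subset_insert k (leOfHom f.unop))))
      (by rw [bd, bd, mapLE_comp, mapLE_comp])
  map_id T := by
    apply coequalizer.hom_ext
    simp [cokernel.map]
    rw [mapLE_refl]
    simp
  map_comp {T U V} f g := by
    apply coequalizer.hom_ext
    simp [cokernel.map]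
    rw [← Category.assoc, mapLE_comp]

/-- Admissibility of an `S`-cube `x` in an abelian category, by recursion on `#S`:
`x` is admissible if all its boundary morphisms `d^k_T` (`k ∈ T ⊆ S`) are monomorphisms and
for every `k ∈ S` the `(S ∖ {k})`-cube `H⁰ₖ(x)` is admissible.  (For `S = ∅` the conditions
are vacuous, and for `#S = 1` this says exactly that the boundary morphism of `x` is a
monomorphism.) -/
def Admissible [Abelian 𝒜] (x : Cube 𝒜 ι) (S : Finset ι) : Prop :=
  (∀ T ⊆ S, ∀ k ∈ T, Mono (x.bd T k)) ∧
  ∀ k, (hk : k ∈ S) → Admissible (x.H0 k) (S.erase k)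
termination_by S.card
decreasing_by exact Finset.card_erase_lt_of_mem hk

/-- Iterated `0`-th homology:
`H0s x [i₁, …, i_r] = H⁰_{i₁}(H⁰_{i₂}(⋯(H⁰_{i_r}(x))⋯))`. -/
noncomputable def H0s [Abelian 𝒜] (x : Cube 𝒜 ι) : List ι → Cube 𝒜 ι
  | [] => x
  | k :: ks => (x.H0s ks).H0 k

/-- The restriction `x|_U^V` of a cube to `U` along `V` (for disjoint `U`, `V`): the
`U`-cube `T ↦ x_{T ∪ V}`.  (It is implemented as the cube `T ↦ x_{(T ∩ U) ∪ V}`, whose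
vertex at any subset `T ⊆ U` is exactly `x_{T ∪ V}`.) -/
def res (x : Cube 𝒜 ι) (U V : Finset ι) : Cube 𝒜 ι :=
  (Monotone.functor (f := fun T : Finset ι => (T ∩ U) ∪ V)
    (fun _ _ h => Finset.union_subset_union (Finset.inter_subset_inter h (subset_refl U))
      (subset_refl V))).op ⋙ x

end Cube

namespace Cube

variable {𝒜 : Type u} [Category.{v} 𝒜] {ι : Type w} [DecidableEq ι]

lemma erase_insert_sub (k : ι) (T : Finset ι) : (insert k T).erase k ⊆ T := by
  intro a; simp

/-- The cokernel projection, with target written as a vertex. -/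
noncomputable def cproj [Abelian 𝒜] (x : Cube 𝒜 ι) (k : ι) (T : Finset ι) :
    x.vtx ((insert k T).erase k) ⟶ (x.H0 k).vtx T :=
  cokernel.π (x.bd (insert k T) k)

lemma cproj_epi [Abelian 𝒜] (x : Cube 𝒜 ι) (k : ι) (T : Finset ι) : Epi (x.cproj k T) :=
  inferInstanceAs (Epi (cokernel.π (x.bd (insert k T) k)))

lemma cproj_nat [Abelian 𝒜] (x : Cube 𝒜 ι) (k : ι) {T U : Finset ι} (h : U ⊆ T) :
    x.cproj k T ≫ (x.H0 k).mapLE h =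
      x.mapLE (Finset.erase_subset_erase k (Finset.insert_subset_insert k h)) ≫
        x.cproj k U := cokernel.π_desc _ _ _

lemma cproj_zero [Abelian 𝒜] (x : Cube 𝒜 ι) (k : ι) (T : Finset ι) :
    x.mapLE (Finset.erase_subset k (insert k T)) ≫ x.cproj k T = 0 :=
  cokernel.condition (x.bd (insert k T) k)

lemma cproj_desc [Abelian 𝒜] (x : Cube 𝒜 ι) (k : ι) (T : Finset ι) {Z : 𝒜}
    (f : x.vtx ((insert k T).erase k) ⟶ Z)
    (hf : x.mapLE (Finset.erase_subset k (insert k T)) ≫ f = 0) :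
    ∃ g : (x.H0 k).vtx T ⟶ Z, x.cproj k T ≫ g = f :=
  ⟨cokernel.desc (x.bd (insert k T) k) f hf, cokernel.π_desc _ _ _⟩

/-- The projection to the cokernel. -/
noncomputable def proj1 [Abelian 𝒜] (x : Cube 𝒜 ι) (k : ι) (T : Finset ι) :
    x.vtx T ⟶ (x.H0 k).vtx T :=
  x.mapLE (erase_insert_sub k T) ≫ x.cproj k T

lemma proj1_nat [Abelian 𝒜] (x : Cube 𝒜 ι) (k : ι) {T U : Finset ι} (h : U ⊆ T) :
    x.mapLE h ≫ x.proj1 k U = x.proj1 k T ≫ (x.H0 k).mapLE h := by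
  unfold proj1
  rw [Category.assoc, cproj_nat, ← Category.assoc, ← Category.assoc, mapLE_comp, mapLE_comp]

lemma proj1_zero [Abelian 𝒜] (x : Cube 𝒜 ι) (k : ι) (T : Finset ι) :
    x.mapLE (Finset.subset_insert k T) ≫ x.proj1 k T = 0 := by
  unfold proj1
  rw [← Category.assoc, mapLE_comp]
  exact cproj_zero x k T

lemma mapLE_inv (x : Cube 𝒜 ι) {T U : Finset ι} (h : U ⊆ T) (h' : T ⊆ U) :
    x.mapLE h ≫ x.mapLE h' = 𝟙 _ := by
  rw [mapLE_comp, mapLE_refl]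

lemma proj1_epi [Abelian 𝒜] (x : Cube 𝒜 ι) (k : ι) (T : Finset ι) (hk : k ∉ T) :
    Epi (x.proj1 k T) := by
  have h' : T ⊆ (insert k T).erase k := by rw [Finset.erase_insert hk]
  have : IsIso (x.mapLE (erase_insert_sub k T)) :=
    ⟨x.mapLE h', mapLE_inv _ _ _, mapLE_inv _ _ _⟩
  have := cproj_epi x k T
  exact epi_comp (x.mapLE (erase_insert_sub k T)) (x.cproj k T)

lemma proj1_desc [Abelian 𝒜] (x : Cube 𝒜 ι) (k : ι) (T : Finset ι) (hk : k ∉ T) {Z : 𝒜}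
    (f : x.vtx T ⟶ Z) (hf : x.mapLE (Finset.subset_insert k T) ≫ f = 0) :
    ∃ g : (x.H0 k).vtx T ⟶ Z, x.proj1 k T ≫ g = f := by
  have h' : T ⊆ (insert k T).erase k := by rw [Finset.erase_insert hk]
  obtain ⟨g, hg⟩ := cproj_desc x k T (x.mapLE h' ≫ f) (by
    rw [← Category.assoc, mapLE_comp, hf])
  refine ⟨g, ?_⟩
  unfold proj1
  rw [Category.assoc, hg, ← Category.assoc, mapLE_inv, Category.id_comp]

/-- The iterated projection. -/
noncomputable def projs [Abelian 𝒜] (x : Cube 𝒜 ι) : (l : List ι) → (T : Finset ι) →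
    (x.vtx T ⟶ (x.H0s l).vtx T)
  | [], T => 𝟙 (x.vtx T)
  | k :: ks, T => projs x ks T ≫ (x.H0s ks).proj1 k T

lemma projs_nat [Abelian 𝒜] (x : Cube 𝒜 ι) (l : List ι) {T U : Finset ι} (h : U ⊆ T) :
    x.mapLE h ≫ x.projs l U = x.projs l T ≫ (x.H0s l).mapLE h := by
  induction l with
  | nil => exact (Category.comp_id _).trans (Category.id_comp _).symm
  | cons k ks ih =>
    show x.mapLE h ≫ projs x ks U ≫ (x.H0s ks).proj1 k U =
      (projs x ks T ≫ (x.H0s ks).proj1 k T) ≫ ((x.H0s ks).H0 k).mapLE h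
    rw [← Category.assoc, ih, Category.assoc, Category.assoc, proj1_nat]

lemma projs_zero [Abelian 𝒜] (x : Cube 𝒜 ι) (l : List ι) (T : Finset ι) (i : ι) (hi : i ∈ l) :
    x.mapLE (Finset.subset_insert i T) ≫ x.projs l T = 0 := by
  induction l with
  | nil => simp at hi
  | cons k ks ih =>
    show x.mapLE (Finset.subset_insert i T) ≫ projs x ks T ≫ (x.H0s ks).proj1 k T = 0
    rw [← Category.assoc]
    rcases List.mem_cons.1 hi with rfl | hi
    · rw [projs_nat, Category.assoc, proj1_zero, comp_zero]
    · rw [ih hi, zero_comp]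

lemma projs_epi [Abelian 𝒜] (x : Cube 𝒜 ι) (l : List ι) (T : Finset ι)
    (hT : ∀ i ∈ l, i ∉ T) : Epi (x.projs l T) := by
  induction l with
  | nil => exact inferInstanceAs (Epi (𝟙 (x.vtx T)))
  | cons k ks ih =>
    have := ih (fun i hi => hT i (List.mem_cons_of_mem _ hi))
    have := proj1_epi (x.H0s ks) k T (hT k List.mem_cons_self)
    exact epi_comp (projs x ks T) ((x.H0s ks).proj1 k T)

lemma projs_desc [Abelian 𝒜] (x : Cube 𝒜 ι) (l : List ι) (hl : l.Nodup) (T : Finset ι)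
    (hT : ∀ i ∈ l, i ∉ T) {Z : 𝒜} (f : x.vtx T ⟶ Z)
    (hf : ∀ i ∈ l, x.mapLE (Finset.subset_insert i T) ≫ f = 0) :
    ∃ g : (x.H0s l).vtx T ⟶ Z, x.projs l T ≫ g = f := by
  induction l with
  | nil => exact ⟨f, Category.id_comp _⟩
  | cons k ks ih =>
    obtain ⟨hk, hks⟩ := List.nodup_cons.1 hl
    obtain ⟨g, hg⟩ := ih hks (fun i hi => hT i (List.mem_cons_of_mem _ hi))
      (fun i hi => hf i (List.mem_cons_of_mem _ hi))
    have hE : Epi (x.projs ks (insert k T)) := projs_epi _ _ _ (by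
      intro i hi h
      rcases Finset.mem_insert.1 h with rfl | h
      · exact hk hi
      · exact hT i (List.mem_cons_of_mem _ hi) h)
    obtain ⟨g', hg'⟩ := proj1_desc (x.H0s ks) k T (hT k List.mem_cons_self) g (by
      rw [← cancel_epi (x.projs ks (insert k T)), ← Category.assoc, ← projs_nat,
        Category.assoc, hg, hf k List.mem_cons_self, comp_zero])
    refine ⟨g', ?_⟩
    show (projs x ks T ≫ (x.H0s ks).proj1 k T) ≫ g' = f
    rw [Category.assoc, hg', hg]

end Cube

/-- Let `x` be an `S`-cube in an abelian category and `U, V ⊆ S` disjoint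
with `#U ≥ 2` such that the restriction `x|_U^V` is admissible.  Then for any two
enumerations of `U`, the corresponding iterated cokernels
`H⁰_{i₁}(⋯(H⁰_{i_k}(x))⋯)_V` are (canonically) isomorphic: the iterated `0`-th homology of
`x` at `V` does not depend on the order of the directions. -/
theorem iterated_H0_independent_of_order {𝒜 : Type u} [Category.{v} 𝒜] [Abelian 𝒜]
    {ι : Type w} [DecidableEq ι] (x : Cube 𝒜 ι) (S U V : Finset ι)
    (hU : U ⊆ S) (hV : V ⊆ S) (hUV : Disjoint U V) (hcard : 2 ≤ U.card)
    (hadm : (x.res U V).Admissible U)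
    (l l' : List ι) (hl : l.Nodup) (hl' : l'.Nodup)
    (hlU : l.toFinset = U) (hl'U : l'.toFinset = U) :
    Nonempty ((x.H0s l).vtx V ≅ (x.H0s l').vtx V) := by
  have hT : ∀ i ∈ l, i ∉ V := fun i hi =>
    Finset.disjoint_left.1 hUV (hlU ▸ List.mem_toFinset.2 hi)
  have hT' : ∀ i ∈ l', i ∉ V := fun i hi =>
    Finset.disjoint_left.1 hUV (hl'U ▸ List.mem_toFinset.2 hi)
  have hmem : ∀ i, i ∈ l ↔ i ∈ l' := fun i => by
    rw [← List.mem_toFinset, ← List.mem_toFinset, hlU, hl'U]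
  obtain ⟨a, ha⟩ := Cube.projs_desc x l hl V hT (x.projs l' V)
    (fun i hi => Cube.projs_zero x l' V i ((hmem i).1 hi))
  obtain ⟨b, hb⟩ := Cube.projs_desc x l' hl' V hT' (x.projs l V)
    (fun i hi => Cube.projs_zero x l V i ((hmem i).2 hi))
  have := Cube.projs_epi x l V hT
  have := Cube.projs_epi x l' V hT'
  refine ⟨⟨a, b, ?_, ?_⟩⟩
  · rw [← cancel_epi (x.projs l V), ← Category.assoc, ha, hb, Category.comp_id]
  · rw [← cancel_epi (x.projs l' V), ← Category.assoc, hb, ha, Category.comp_id]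
end

section
/- Let x be an admissible S-cube in an abelian category (S a finite set). Then for every pair of disjoint subsets U, V of S, the restriction x|_U^V is admissible. In particular, when #S ≥ 1, all faces of x (the backside k-face x|_{S∖{k}}^{{k}} and the frontside k-face x|_{S∖{k}}^{∅}, for k ∈ S) are admissible. -/
open CategoryTheory CategoryTheory.Limits Opposite

attribute [local instance] CategoryTheory.Abelian.hasFiniteBiproducts

set_option linter.unusedSectionVars false

universe w v u

namespace Cube

lemma coker_sq {𝒜 : Type u} [Category.{v} 𝒜] [Abelian 𝒜]
    {A B A₁ B₁ A₂ B₂ A₃ B₃ : 𝒜} (f : A ⟶ B) (f₁ : A₁ ⟶ B₁) (f₂ : A₂ ⟶ B₂) (f₃ : A₃ ⟶ B₃)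
    (p₁ : A ⟶ A₁) (q₁ : B ⟶ B₁) (p₂ : A ⟶ A₂) (q₂ : B ⟶ B₂)
    (p₃ : A₁ ⟶ A₃) (q₃ : B₁ ⟶ B₃) (p₄ : A₂ ⟶ A₃) (q₄ : B₂ ⟶ B₃)
    (h₁ : f ≫ q₁ = p₁ ≫ f₁) (h₂ : f ≫ q₂ = p₂ ≫ f₂)
    (h₃ : f₁ ≫ q₃ = p₃ ≫ f₃) (h₄ : f₂ ≫ q₄ = p₄ ≫ f₃)
    (h : q₁ ≫ q₃ = q₂ ≫ q₄) :
    cokernel.map f f₁ p₁ q₁ h₁ ≫ cokernel.map f₁ f₃ p₃ q₃ h₃ =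
      cokernel.map f f₂ p₂ q₂ h₂ ≫ cokernel.map f₂ f₃ p₄ q₄ h₄ := by
  apply coequalizer.hom_ext
  simp [cokernel.map, reassoc_of% h]

lemma mono_mapLE {𝒜 : Type u} [Category.{v} 𝒜] {ι : Type w} [DecidableEq ι]
    (x : Cube 𝒜 ι) (T W : Finset ι) (k : ι) (h : W ⊆ T) (hW : W = T.erase k)
    (hm : Mono (x.bd T k)) : Mono (x.mapLE h) := by
  subst hW
  exact hm

lemma admissible_aux {𝒜 : Type u} [Category.{v} 𝒜] [Abelian 𝒜] {ι : Type w} [DecidableEq ι]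
    (n : ℕ) : ∀ (x y : Cube 𝒜 ι) (S U V : Finset ι), U.card = n → U ⊆ S → V ⊆ S →
    Disjoint U V → x.Admissible S →
    ∀ (e : ∀ T W : Finset ι, T ⊆ U → W = T ∪ V → (y.vtx T ≅ x.vtx W)),
    (∀ (T W T' W' : Finset ι) (hT : T ⊆ U) (hW : W = T ∪ V) (hT' : T' ⊆ U) (hW' : W' = T' ∪ V)
      (h : T' ⊆ T) (h' : W' ⊆ W),
      y.mapLE h ≫ (e T' W' hT' hW').hom = (e T W hT hW).hom ≫ x.mapLE h') →
    y.Admissible U := by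
  induction n with
  | zero =>
    intro x y S U V hc _ _ _ _ _ _
    rw [Finset.card_eq_zero] at hc
    subst hc
    rw [Admissible]
    refine ⟨fun T hT k hk => absurd (hT hk) (by simp), fun k hk => absurd hk (by simp)⟩
  | succ n ih =>
    intro x y S U V hc hU hV hd hx e he
    rw [Admissible] at hx ⊢
    have hkV : ∀ k ∈ U, k ∉ V := fun k hk => Finset.disjoint_left.1 hd hk
    refine ⟨fun T hT k hk => ?_, fun k hk => ?_⟩
    · have hT' := (Finset.erase_subset k T).trans hT
      have h' : T.erase k ∪ V ⊆ T ∪ V :=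
        Finset.union_subset_union (Finset.erase_subset k T) (subset_refl V)
      have hm := mono_mapLE x (T ∪ V) (T.erase k ∪ V) k h'
        (by have := hkV k (hT hk); ext a; simp only [Finset.mem_union, Finset.mem_erase]; grind)
        (hx.1 _ (Finset.union_subset (hT.trans hU) hV) k (Finset.mem_union_left _ hk))
      have hn := he T _ (T.erase k) _ hT rfl hT' rfl (Finset.erase_subset k T) h'
      have : Mono (y.bd T k ≫ (e (T.erase k) _ hT' rfl).hom) := by
        rw [bd, hn]
        exact mono_comp _ _
      exact mono_of_mono _ (e (T.erase k) _ hT' rfl).hom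
    · have hkV := hkV k hk
      have a1 : ∀ T, T ⊆ U.erase k → insert k T ⊆ U := by grind
      have a2 : ∀ T W, W = T ∪ V → insert k W = insert k T ∪ V := by grind
      have a3 : ∀ T, T ⊆ U.erase k → (insert k T).erase k ⊆ U := by grind
      have a4 : ∀ T W, W = T ∪ V → (insert k W).erase k = (insert k T).erase k ∪ V := by
        clear a1 a2 a3 he e ih hx
        grind
      refine ih (x.H0 k) (y.H0 k) (S.erase k) (U.erase k) V
        (by rw [Finset.card_erase_of_mem hk, hc]; rfl)
        (Finset.erase_subset_erase k hU) (Finset.subset_erase.2 ⟨hV, hkV⟩)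
        (hd.mono_left (Finset.erase_subset _ _)) (hx.2 k (hU hk))
        (fun T W hT hW => cokernel.mapIso (y.bd (insert k T) k) (x.bd (insert k W) k)
          (e _ _ (a1 T hT) (a2 T W hW)) (e _ _ (a3 T hT) (a4 T W hW))
          (he _ _ _ _ _ _ _ _ _ _)) ?_
      intro T W T' W' hT hW hT' hW' h h'
      have hn := he _ _ _ _ (a3 T hT) (a4 T W hW) (a3 T' hT') (a4 T' W' hW')
        (Finset.erase_subset_erase k (Finset.insert_subset_insert k h))
        (Finset.erase_subset_erase k (Finset.insert_subset_insert k h'))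
      exact coker_sq (y.bd (insert k T) k) (y.bd (insert k T') k) (x.bd (insert k W) k)
        (x.bd (insert k W') k)
        (y.mapLE (Finset.insert_subset_insert k h)) _
        (e _ _ (a1 T hT) (a2 T W hW)).hom _
        (e _ _ (a1 T' hT') (a2 T' W' hW')).hom _
        (x.mapLE (Finset.insert_subset_insert k h')) _
        (by rw [bd, bd, mapLE_comp, mapLE_comp]) (he _ _ _ _ _ _ _ _ _ _)
        (he _ _ _ _ _ _ _ _ _ _) (by rw [bd, bd, mapLE_comp, mapLE_comp]) hn

lemma admissible_res {𝒜 : Type u} [Category.{v} 𝒜] [Abelian 𝒜] {ι : Type w} [DecidableEq ι]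
    (x : Cube 𝒜 ι) (S U V : Finset ι) (hx : x.Admissible S) (hU : U ⊆ S) (hV : V ⊆ S)
    (hd : Disjoint U V) : (x.res U V).Admissible U := by
  have key : ∀ T W : Finset ι, T ⊆ U → W = T ∪ V → W = (T ∩ U) ∪ V := by
    intro T W hT hW
    rw [Finset.inter_eq_left.2 hT, hW]
  refine admissible_aux U.card x (x.res U V) S U V rfl hU hV hd hx
    (fun T W hT hW =>
      { hom := x.mapLE (T := (T ∩ U) ∪ V) (U := W) (key T W hT hW).subset
        inv := x.mapLE (U := (T ∩ U) ∪ V) (T := W) (key T W hT hW).symm.subset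
        hom_inv_id := (mapLE_comp x _ _).trans (mapLE_refl x _ _)
        inv_hom_id := (mapLE_comp x _ _).trans (mapLE_refl x _ _) }) ?_
  intro T W T' W' hT hW hT' hW' h h'
  exact (mapLE_comp x (Finset.union_subset_union (Finset.inter_subset_inter h (subset_refl U))
      (subset_refl V)) _).trans (mapLE_comp x _ _).symm

end Cube

/-- If `x` is an admissible `S`-cube in an abelian category, then for
every pair of disjoint subsets `U, V ⊆ S` the restriction `x|_U^V` is admissible (as a
`U`-cube).  In particular, when `S` is nonempty, all faces `x|_{S∖{k}}^{{k}}` and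
`x|_{S∖{k}}^{∅}` (`k ∈ S`) of `x` are admissible. -/
theorem admissible_restriction {𝒜 : Type u} [Category.{v} 𝒜] [Abelian 𝒜]
    {ι : Type w} [DecidableEq ι] (x : Cube 𝒜 ι) (S : Finset ι)
    (hadm : x.Admissible S) :
    (∀ U V : Finset ι, U ⊆ S → V ⊆ S → Disjoint U V → (x.res U V).Admissible U) ∧
    (S.Nonempty → ∀ k ∈ S,
      (x.res (S.erase k) {k}).Admissible (S.erase k) ∧
      (x.res (S.erase k) ∅).Admissible (S.erase k)) := by
  have main : ∀ U V : Finset ι, U ⊆ S → V ⊆ S → Disjoint U V → (x.res U V).Admissible U :=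
    fun U V hU hV hd => Cube.admissible_res x S U V hadm hU hV hd
  exact ⟨main, fun _ k hk =>
    ⟨main _ _ (Finset.erase_subset _ _) (by simpa using hk) (by simp),
      main _ _ (Finset.erase_subset _ _) (by simp) (by simp)⟩⟩
end
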